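/- Fix y ∈ ℝ² with 0 < ‖y‖ < 1. The function x ↦ G(x,y) = (1/4π) ln( ((x₁−y₁)² + (x₂−y₂)²) / ((x₁y₂ − x₂y₁)² + (x₁y₁ + x₂y₂ − 1)²) ) is harmonic on the open unit disk punctured at y: at every x with ‖x‖ < 1 and x ≠ y, the second partial derivatives exist and ∂²G/∂x₁² + ∂²G/∂x₂² = 0. -/

import Mathlib

lemma aux_second (c : ℝ) (P Q P' Q' : ℝ → ℝ) (P2 Q2 a : ℝ)
    (hP : ∀ s, HasDerivAt P (P' s) s) (hQ : ∀ s, HasDerivAt Q (Q' s) s)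
    (hP2 : HasDerivAt P' P2 a) (hQ2 : HasDerivAt Q' Q2 a)
    (hPa : P a ≠ 0) (hQa : Q a ≠ 0) :
    iteratedDeriv 2 (fun s => c * Real.log (P s / Q s)) a =
      c * ((P2 * P a - P' a * P' a) / P a ^ 2 - (Q2 * Q a - Q' a * Q' a) / Q a ^ 2) := by
  have hd : deriv (fun s => c * Real.log (P s / Q s)) =ᶠ[nhds a]
      fun s => c * (P' s / P s - Q' s / Q s) := by
    filter_upwards [(hP a).continuousAt.eventually_ne hPa,
      (hQ a).continuousAt.eventually_ne hQa] with s h1 h2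
    have := (((hP s).div (hQ s) h2).log (div_ne_zero h1 h2)).const_mul c
    refine this.deriv.trans ?_
    simp only [Pi.div_apply]
    field_simp
  rw [iteratedDeriv_succ, iteratedDeriv_one, hd.deriv_eq]
  exact (((hP2.div (hP a) hPa).sub (hQ2.div (hQ a) hQa)).const_mul c).deriv

/-- Fix `y = (y₁,y₂) ∈ ℝ²` with `0 < ‖y‖ < 1`. The unit-disk Green's function
`x ↦ G(x,y) = (1/4π) ln( ((x₁−y₁)² + (x₂−y₂)²) / ((x₁y₂ − x₂y₁)² + (x₁y₁ + x₂y₂ − 1)²) )`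
is harmonic on the open unit disk punctured at `y`: at every `x = (a,b)` with `‖x‖ < 1`
and `x ≠ y`, the second partial derivatives exist and `∂²G/∂x₁² + ∂²G/∂x₂² = 0`. -/
theorem disk_green_harmonic (y₁ y₂ : ℝ)
    (hy0 : 0 < Real.sqrt (y₁ ^ 2 + y₂ ^ 2)) (hy1 : Real.sqrt (y₁ ^ 2 + y₂ ^ 2) < 1)
    (a b : ℝ) (hx : Real.sqrt (a ^ 2 + b ^ 2) < 1) (hxy : (a, b) ≠ (y₁, y₂)) :
    ContDiffAt ℝ 2 (fun s : ℝ => (1 / (4 * Real.pi)) * Real.log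
      (((s - y₁) ^ 2 + (b - y₂) ^ 2) /
        ((s * y₂ - b * y₁) ^ 2 + (s * y₁ + b * y₂ - 1) ^ 2))) a ∧
    ContDiffAt ℝ 2 (fun t : ℝ => (1 / (4 * Real.pi)) * Real.log
      (((a - y₁) ^ 2 + (t - y₂) ^ 2) /
        ((a * y₂ - t * y₁) ^ 2 + (a * y₁ + t * y₂ - 1) ^ 2))) b ∧
    iteratedDeriv 2 (fun s : ℝ => (1 / (4 * Real.pi)) * Real.log
      (((s - y₁) ^ 2 + (b - y₂) ^ 2) /
        ((s * y₂ - b * y₁) ^ 2 + (s * y₁ + b * y₂ - 1) ^ 2))) a +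
    iteratedDeriv 2 (fun t : ℝ => (1 / (4 * Real.pi)) * Real.log
      (((a - y₁) ^ 2 + (t - y₂) ^ 2) /
        ((a * y₂ - t * y₁) ^ 2 + (a * y₁ + t * y₂ - 1) ^ 2))) b = 0 := by
  have hy : y₁ ^ 2 + y₂ ^ 2 < 1 := by
    rwa [Real.sqrt_lt' one_pos, one_pow] at hy1
  have hab : a ^ 2 + b ^ 2 < 1 := by
    rwa [Real.sqrt_lt' one_pos, one_pow] at hx
  have hP : (a - y₁) ^ 2 + (b - y₂) ^ 2 ≠ 0 := by
    intro h
    apply hxy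
    have h1 : (a - y₁) ^ 2 = 0 := by nlinarith [sq_nonneg (a - y₁), sq_nonneg (b - y₂)]
    have h2 : (b - y₂) ^ 2 = 0 := by nlinarith [sq_nonneg (a - y₁), sq_nonneg (b - y₂)]
    rw [sub_eq_zero.mp (pow_eq_zero_iff two_ne_zero |>.mp h1),
      sub_eq_zero.mp (pow_eq_zero_iff two_ne_zero |>.mp h2)]
  have hQ : (a * y₂ - b * y₁) ^ 2 + (a * y₁ + b * y₂ - 1) ^ 2 ≠ 0 := by
    have : a * y₁ + b * y₂ < 1 := by
      nlinarith [sq_nonneg (a - y₁), sq_nonneg (b - y₂)]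
    have : (0:ℝ) < (a * y₁ + b * y₂ - 1) ^ 2 := by
      exact sq_pos_of_neg (by linarith)
    positivity
  refine ⟨?_, ?_, ?_⟩
  · refine contDiffAt_const.mul (ContDiffAt.log (ContDiffAt.div (by fun_prop) (by fun_prop) hQ)
      (div_ne_zero hP hQ))
  · refine contDiffAt_const.mul (ContDiffAt.log (ContDiffAt.div (by fun_prop) (by fun_prop) hQ)
      (div_ne_zero hP hQ))
  · rw [aux_second (1 / (4 * Real.pi)) (fun s => (s - y₁) ^ 2 + (b - y₂) ^ 2)
        (fun s => (s * y₂ - b * y₁) ^ 2 + (s * y₁ + b * y₂ - 1) ^ 2)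
        (fun s => 2 * (s - y₁))
        (fun s => 2 * (s * y₂ - b * y₁) * y₂ + 2 * (s * y₁ + b * y₂ - 1) * y₁)
        2 (2 * (y₁ ^ 2 + y₂ ^ 2)) a ?_ ?_ ?_ ?_ hP hQ,
      aux_second (1 / (4 * Real.pi)) (fun t => (a - y₁) ^ 2 + (t - y₂) ^ 2)
        (fun t => (a * y₂ - t * y₁) ^ 2 + (a * y₁ + t * y₂ - 1) ^ 2)
        (fun t => 2 * (t - y₂))
        (fun t => 2 * (a * y₂ - t * y₁) * (-y₁) + 2 * (a * y₁ + t * y₂ - 1) * y₂)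
        2 (2 * (y₁ ^ 2 + y₂ ^ 2)) b ?_ ?_ ?_ ?_ hP hQ]
    · rw [← mul_add, mul_eq_zero]
      right
      have e : ∀ x y z w p q : ℝ, x + z = 0 → y + w = 0 →
          (x / p - y / q) + (z / p - w / q) = 0 := by
        intro x y z w p q h1 h2
        have : (x / p - y / q) + (z / p - w / q) = (x + z) / p - (y + w) / q := by ring
        rw [this, h1, h2]; simp
      apply e
      · ring
      · ring
    · intro t
      have := (((hasDerivAt_id t).sub_const y₂).pow 2).const_add ((a - y₁) ^ 2)
      refine HasDerivAt.congr_deriv this ?_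
      simp [id]
    · intro t
      have := (((((hasDerivAt_id t).mul_const y₁).const_sub (a * y₂))).pow 2).add
        (((((hasDerivAt_id t).mul_const y₂).const_add (a * y₁)).sub_const 1).pow 2)
      refine HasDerivAt.congr_deriv this ?_
      simp [id]
    · have := ((hasDerivAt_id b).sub_const y₂).const_mul 2
      refine HasDerivAt.congr_deriv this ?_
      simp [id]
    · have := (((((hasDerivAt_id b).mul_const y₁).const_sub (a * y₂)).const_mul 2).mul_const (-y₁)).add
        (((((hasDerivAt_id b).mul_const y₂).const_add (a * y₁)).sub_const 1).const_mul 2 |>.mul_const y₂)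
      refine HasDerivAt.congr_deriv this ?_
      simp [id]
      ring
    · intro t
      have := (((hasDerivAt_id t).sub_const y₁).pow 2).add_const ((b - y₂) ^ 2)
      refine HasDerivAt.congr_deriv this ?_
      simp [id]
    · intro t
      have := (((((hasDerivAt_id t).mul_const y₂).sub_const (b * y₁))).pow 2).add
        (((((hasDerivAt_id t).mul_const y₁).add_const (b * y₂)).sub_const 1).pow 2)
      refine HasDerivAt.congr_deriv this ?_
      simp [id]
    · have := ((hasDerivAt_id a).sub_const y₁).const_mul 2
      refine HasDerivAt.congr_deriv this ?_
      simp [id]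
    · have := (((((hasDerivAt_id a).mul_const y₂).sub_const (b * y₁)).const_mul 2).mul_const y₂).add
        (((((hasDerivAt_id a).mul_const y₁).add_const (b * y₂)).sub_const 1).const_mul 2 |>.mul_const y₁)
      refine HasDerivAt.congr_deriv this ?_
      simp [id]
      ring
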